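/- Let $S_n$ be the number of simple chords in a uniformly random chord diagram of size $n \geq 2$, let $\lambda_n = \frac{2n}{2n-1}$, and let $Y_n$ be a Poisson random variable with mean $\lambda_n$. Then $d_{TV}(S_n, Y_n) \leq \frac{10n}{(2n-1)^2} \leq \frac{10}{n}$. -/

import Mathlib

open MeasureTheory ProbabilityTheory Filter
open scoped Nat NNReal

instance {N : ℕ} : MeasurableSpace (Equiv.Perm (Fin N)) := ⊤

/-- A chord diagram of size `n` is a fixed-point-free involution of `{1,…,2n}`. -/
def IsChordDiagram {n : ℕ} (π : Equiv.Perm (Fin (2 * n))) : Prop :=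
  (∀ i, π (π i) = i) ∧ ∀ i, π i ≠ i

/-- The uniform probability measure on chord diagrams of size `n`. -/
noncomputable def uniformCD (n : ℕ) : Measure (Equiv.Perm (Fin (2 * n))) :=
  uniformOn {π | IsChordDiagram π}

/-- The number of crossings: quadruples `i < j < k < l` with `π i = k` and `π j = l`. -/
def crossings {n : ℕ} (π : Equiv.Perm (Fin (2 * n))) : ℕ :=
  ((Finset.univ : Finset (Fin (2 * n) × Fin (2 * n) × Fin (2 * n) × Fin (2 * n))).filter
    (fun q => q.1 < q.2.1 ∧ q.2.1 < q.2.2.1 ∧ q.2.2.1 < q.2.2.2 ∧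
      π q.1 = q.2.2.1 ∧ π q.2.1 = q.2.2.2)).card

/-- The number of simple chords: indices `k` with `π k = k + 1 (mod 2n)`. -/
def simpleChords {n : ℕ} (π : Equiv.Perm (Fin (2 * n))) : ℕ :=
  (Finset.univ.filter (fun k => π k = finRotate (2 * n) k)).card

/-- Solution of the Stein equation of a probability mass function `p` on `ℕ` satisfying the
Poisson recursion, with the usual bound on its increments. -/
theorem exists_poisson_stein_solution {r : ℝ} (hr : 0 < r) {p : ℕ → ℝ} (hp : ∀ j, 0 < p j)
    (hrec : ∀ j, r * p j = (j + 1) * p (j + 1)) (hsum : HasSum p 1)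
    {f : ℕ → ℝ} (hf0 : ∀ j, 0 ≤ f j) (hf1 : ∀ j, f j ≤ 1) :
    ∃ g : ℕ → ℝ, (∀ j : ℕ, r * g (j + 1) - j * g j = f j - ∑' i, f i * p i) ∧
      ∀ j : ℕ, 1 ≤ j → |g (j + 1) - g j| ≤ 1 / r := by
  have hfp : Summable fun i => f i * p i :=
    Summable.of_nonneg_of_le (fun i => mul_nonneg (hf0 i) (hp i).le)
      (fun i => mul_le_of_le_one_left (hp i).le (hf1 i)) hsum.summable
  set t := ∑' i, f i * p i with ht
  let g : ℕ → ℝ := fun j => (∑ i ∈ Finset.range j, (f i - t) * p i) / (j * p j)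
  have hg1 : ∀ j : ℕ, r * g (j + 1) = (∑ i ∈ Finset.range (j + 1), (f i - t) * p i) / p j := by
    intro j
    have h1 := hp j
    simp only [g]
    push_cast
    rw [← hrec j]
    field_simp
  have hg0 : ∀ j : ℕ, j * g j = (∑ i ∈ Finset.range j, (f i - t) * p i) / p j := by
    intro j
    have h1 := hp j
    rcases Nat.eq_zero_or_pos j with rfl | hj
    · simp
    · have : (0 : ℝ) < j := by exact_mod_cast hj
      simp only [g]
      field_simp
  refine ⟨g, fun j => ?_, fun j hj => ?_⟩
  · have h1 := hp j
    rw [hg1, hg0, Finset.sum_range_succ]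
    field_simp
    ring
  have hj0 : (0 : ℝ) < j := by exact_mod_cast hj
  have hpj := hp j
  set X := ∑' i, p (i + (j + 1)) with hX
  set x := ∑' i, f (i + (j + 1)) * p (i + (j + 1)) with hx
  set Y := ∑ i ∈ Finset.range j, p i with hY
  set y := ∑ i ∈ Finset.range j, f i * p i with hy
  have hXs : Summable fun i => p (i + (j + 1)) := (summable_nat_add_iff (j + 1)).2 hsum.summable
  have hxs : Summable fun i => f (i + (j + 1)) * p (i + (j + 1)) :=
    (summable_nat_add_iff (f := fun i => f i * p i) (j + 1)).2 hfp
  have htot : Y + p j + X = 1 := by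
    rw [hY, ← Finset.sum_range_succ, hX, hsum.summable.sum_add_tsum_nat_add, hsum.tsum_eq]
  have htott : y + f j * p j + x = t := by
    rw [hy, ← Finset.sum_range_succ (fun i => f i * p i), hx,
      hfp.sum_add_tsum_nat_add]
  have hx0 : 0 ≤ x := tsum_nonneg fun i => mul_nonneg (hf0 _) (hp _).le
  have hxX : x ≤ X := hxs.tsum_le_tsum (fun i => mul_le_of_le_one_left (hp _).le (hf1 _)) hXs
  have hy0 : 0 ≤ y := Finset.sum_nonneg fun i _ => mul_nonneg (hf0 _) (hp _).le
  have hyY : y ≤ Y := Finset.sum_le_sum fun i _ => mul_le_of_le_one_left (hp _).le (hf1 _)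
  have hYr : r * Y ≤ j * (1 - X) := by
    have h1 : r * Y ≤ j * ∑ i ∈ Finset.range j, p (i + 1) := by
      rw [hY, Finset.mul_sum, Finset.mul_sum]
      refine Finset.sum_le_sum fun i hi => ?_
      rw [hrec]
      have : (i : ℝ) + 1 ≤ j := by exact_mod_cast Finset.mem_range.1 hi
      exact mul_le_mul_of_nonneg_right this (hp _).le
    have h2 : ∑ i ∈ Finset.range j, p (i + 1) + p 0 = Y + p j := by
      rw [← Finset.sum_range_succ', Finset.sum_range_succ]
    refine h1.trans (mul_le_mul_of_nonneg_left ?_ hj0.le)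
    linarith [hp 0]
  have hXj : j * X ≤ r * (1 - Y) := by
    have hs : Summable fun i => p (i + j) := (summable_nat_add_iff j).2 hsum.summable
    have h1 : 1 - Y = ∑' i, p (i + j) := by
      rw [← hsum.tsum_eq, ← hsum.summable.sum_add_tsum_nat_add j]; ring
    rw [h1, hX, ← tsum_mul_left, ← tsum_mul_left]
    refine (hXs.mul_left _).tsum_le_tsum (fun i => ?_) (hs.mul_left _)
    rw [hrec, ← add_assoc]
    refine mul_le_mul_of_nonneg_right ?_ (hp _).le
    push_cast
    linarith [(Nat.cast_nonneg i : (0 : ℝ) ≤ i)]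
  set c := X / r + Y / j with hc
  have hc1 : c ≤ 1 / r := by
    rw [hc, div_add_div _ _ hr.ne' hj0.ne', div_le_div_iff₀ (by positivity) hr]
    nlinarith
  have hc2 : c ≤ 1 / j := by
    rw [hc, div_add_div _ _ hr.ne' hj0.ne', div_le_div_iff₀ (by positivity) hj0]
    nlinarith
  have hc0 : 0 ≤ c := by
    have : 0 ≤ X := hx0.trans hxX
    have : 0 ≤ Y := hy0.trans hyY
    positivity
  have hdiff : p j * (g (j + 1) - g j) = t * c - x / r - y / j := by
    have e1 : ∑ i ∈ Finset.range j, (f i - t) * p i = y - t * Y := by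
      simp only [sub_mul, Finset.sum_sub_distrib, ← Finset.mul_sum, hy, hY]
    have e2 : g (j + 1) = (t * X - x) / p j / r := by
      rw [eq_div_iff hr.ne', mul_comm, hg1, Finset.sum_range_succ, e1]
      congr 1
      linear_combination htott - t * htot
    have e3 : g j = (y - t * Y) / p j / j := by
      rw [eq_div_iff hj0.ne', mul_comm, hg0, e1]
    rw [e2, e3, hc]
    field_simp
    ring
  have hz0 : 0 ≤ f j * p j := mul_nonneg (hf0 _) hpj.le
  have hz1 : f j * p j ≤ p j := mul_le_of_le_one_left hpj.le (hf1 _)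
  have key : |p j * (g (j + 1) - g j)| ≤ p j * c := by
    rw [hdiff, abs_le]
    have hXY : (X + Y + p j) * c - X / r - Y / j = 0 := by
      rw [show X + Y + p j = 1 by linarith, hc]
      ring
    have hxr : x / r = x * (1 / r) := by ring
    have hXr : X / r = X * (1 / r) := by ring
    have hyj : y / j = y * (1 / j) := by ring
    have hYj : Y / j = Y * (1 / j) := by ring
    rw [hXr, hYj] at hXY
    rw [← htott, hxr, hyj]
    constructor
    · nlinarith [mul_le_mul_of_nonneg_left hc1 (sub_nonneg.2 hxX),
        mul_le_mul_of_nonneg_left hc2 (sub_nonneg.2 hyY), mul_nonneg hz0 hc0]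
    · nlinarith [mul_le_mul_of_nonneg_left hc1 hx0, mul_le_mul_of_nonneg_left hc2 hy0,
        mul_le_mul_of_nonneg_right hz1 hc0]
  rw [abs_mul, abs_of_pos hpj] at key
  exact (le_of_mul_le_mul_left key hpj).trans hc1

section Matchings
open Equiv

variable {α : Type*} [Fintype α] [DecidableEq α]

/-- The fixed-point-free involutions of a finite type. -/
def matchings (α : Type*) [Fintype α] [DecidableEq α] : Finset (Perm α) :=
  Finset.univ.filter fun π => (∀ i, π (π i) = i) ∧ ∀ i, π i ≠ i

theorem mem_matchings {π : Perm α} :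
    π ∈ matchings α ↔ (∀ i, π (π i) = i) ∧ ∀ i, π i ≠ i := by
  simp [matchings]

theorem swap_mul_mul_swap_mem_matchings {π : Perm α} (hπ : π ∈ matchings α) (a b : α) :
    swap a b * π * swap a b ∈ matchings α := by
  rw [mem_matchings] at hπ ⊢
  refine ⟨fun i => ?_, fun i h => hπ.2 (swap a b i) ?_⟩
  · simp [hπ.1]
  · simpa using congrArg (swap a b) h

theorem swap_mul_mul_swap_involutive {α : Type*} [DecidableEq α] (a b : α) :
    Function.Involutive fun π : Perm α => swap a b * π * swap a b := by
  intro π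
  ext i
  simp

/-- Conjugation by `swap m m'` matches the matchings sending `k` to `m` with those sending
`k` to `m'`. -/
theorem sum_matchings_swap {M : Type*} [AddCommMonoid M] {k m m' : α} (hm : m ≠ k) (hm' : m' ≠ k)
    (f : Perm α → M) :
    ∑ π ∈ matchings α with π k = m, f (swap m' m * π * swap m' m) =
      ∑ π ∈ matchings α with π k = m', f π := by
  have hk : swap m' m k = k := swap_apply_of_ne_of_ne hm'.symm hm.symm
  refine Finset.sum_nbij' (fun π => swap m' m * π * swap m' m)
    (fun π => swap m' m * π * swap m' m) ?_ ?_ ?_ ?_ ?_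
  · intro π hπ
    rw [Finset.mem_filter] at hπ ⊢
    exact ⟨swap_mul_mul_swap_mem_matchings hπ.1 _ _, by simp [hk, hπ.2]⟩
  · intro π hπ
    rw [Finset.mem_filter] at hπ ⊢
    exact ⟨swap_mul_mul_swap_mem_matchings hπ.1 _ _, by simp [hk, hπ.2]⟩
  · exact fun π _ => swap_mul_mul_swap_involutive _ _ π
  · exact fun π _ => swap_mul_mul_swap_involutive _ _ π
  · exact fun π _ => rfl

/-- The matchings are equidistributed over the possible partners of `k`. -/
theorem sum_matchings_reconnect (k c : α) (hc : c ≠ k) (f : Perm α → ℝ) :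
    ∑ π ∈ matchings α, f (swap c (π k) * π * swap c (π k)) =
      (Fintype.card α - 1) * ∑ π ∈ matchings α with π k = c, f π := by
  rw [← Finset.sum_fiberwise_of_maps_to (s := matchings α) (t := Finset.univ.erase k)
    (g := fun π => π k) (fun π hπ => by simpa using (mem_matchings.1 hπ).2 k)]
  rw [Finset.sum_congr rfl (g := fun _ => ∑ π ∈ matchings α with π k = c, f π)]
  · rw [Finset.sum_const, Finset.card_erase_of_mem (Finset.mem_univ k), nsmul_eq_mul,
      Finset.card_univ, Nat.cast_pred (Fintype.card_pos_iff.2 ⟨k⟩)]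
  · intro m hm
    rw [← sum_matchings_swap (Finset.ne_of_mem_erase hm) hc]
    refine Finset.sum_congr rfl fun π hπ => ?_
    rw [(Finset.mem_filter.1 hπ).2]

theorem card_matchings_apply_eq {k c : α} (hc : c ≠ k) :
    ((Fintype.card α : ℝ) - 1) * ((matchings α).filter fun π => π k = c).card =
      (matchings α).card := by
  have h := sum_matchings_reconnect k c hc fun _ => 1
  simpa using h.symm

theorem card_matchings_apply_eq_apply_eq {k m c b : α} (hmk : m ≠ k) (hck : c ≠ k) (hcm : c ≠ m)
    (hbk : b ≠ k) (hbm : b ≠ m) (hbc : b ≠ c) :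
    ((Fintype.card α : ℝ) - 1) * (Fintype.card α - 3) *
      ((matchings α).filter fun π => π k = m ∧ π c = b).card = (matchings α).card := by
  have hS : ({k, m, c} : Finset α).card = 3 := by
    rw [Finset.card_eq_three]; exact ⟨k, m, c, hmk.symm, hck.symm, hcm.symm, rfl⟩
  rw [← card_matchings_apply_eq hmk, mul_assoc]
  congr 1
  have hmaps : ∀ π ∈ (matchings α).filter (fun π => π k = m), π c ∈ ({k, m, c} : Finset α)ᶜ := by
    intro π hπ
    obtain ⟨h1, h2⟩ := Finset.mem_filter.1 hπ
    obtain ⟨h3, h4⟩ := mem_matchings.1 h1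
    simp only [Finset.mem_compl, Finset.mem_insert, Finset.mem_singleton, not_or]
    refine ⟨fun h => hcm ?_, fun h => hck ?_, h4 c⟩
    · rw [← h3 c, h, h2]
    · rw [← h3 c, h, ← h2, h3]
  rw [Finset.card_eq_sum_card_fiberwise hmaps, Finset.sum_congr rfl
    (g := fun _ => ((matchings α).filter fun π => π k = m ∧ π c = b).card)]
  · rw [Finset.sum_const, Finset.card_compl, hS, smul_eq_mul, Nat.cast_mul, Nat.cast_sub]
    · simp
    · rw [← hS]; exact Finset.card_le_univ _
  · intro b' hb'
    simp only [Finset.mem_compl, Finset.mem_insert, Finset.mem_singleton, not_or] at hb'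
    obtain ⟨h1, h2, h3⟩ := hb'
    rw [Finset.filter_filter]
    have e1 : swap b b' k = k := swap_apply_of_ne_of_ne hbk.symm (Ne.symm h1)
    have e2 : swap b b' m = m := swap_apply_of_ne_of_ne hbm.symm (Ne.symm h2)
    have e3 : swap b b' c = c := swap_apply_of_ne_of_ne hbc.symm (Ne.symm h3)
    refine Finset.card_nbij' (fun π => swap b b' * π * swap b b')
      (fun π => swap b b' * π * swap b b') ?_ ?_ ?_ ?_
    · intro π hπ
      rw [Finset.mem_coe, Finset.mem_filter] at hπ ⊢
      exact ⟨swap_mul_mul_swap_mem_matchings hπ.1 _ _, by simp [e1, e2, e3, hπ.2]⟩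
    · intro π hπ
      rw [Finset.mem_coe, Finset.mem_filter] at hπ ⊢
      exact ⟨swap_mul_mul_swap_mem_matchings hπ.1 _ _, by simp [e1, e2, e3, hπ.2]⟩
    · exact fun π _ => swap_mul_mul_swap_involutive _ _ π
    · exact fun π _ => swap_mul_mul_swap_involutive _ _ π

/-- For a permutation `e` without fixed points, a bound on the number of matchings in which the
partner of `c` is the image under `e` of the partner of `k`. -/
theorem card_matchings_apply_eq_perm_apply_le (e : Perm α) (he : ∀ i, e i ≠ i) {k c : α}
    (hck : c ≠ k) :
    ((Fintype.card α : ℝ) - 1) * (Fintype.card α - 3) *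
      ((matchings α).filter fun π => π k ≠ c ∧ π c = e (π k)).card ≤
      (Fintype.card α - 2) * (matchings α).card := by
  have hS : ({k, c} : Finset α).card = 2 := Finset.card_pair hck.symm
  have hmaps : ∀ π ∈ (matchings α).filter (fun π => π k ≠ c ∧ π c = e (π k)),
      π k ∈ ({k, c} : Finset α)ᶜ := by
    intro π hπ
    obtain ⟨h1, h2, -⟩ := Finset.mem_filter.1 hπ
    simp [h2, (mem_matchings.1 h1).2 k]
  have hcard : (((({k, c} : Finset α)ᶜ).card : ℕ) : ℝ) = Fintype.card α - 2 := by
    rw [Finset.card_compl, hS, Nat.cast_sub (by rw [← hS]; exact Finset.card_le_univ _)]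
    simp
  rw [Finset.card_eq_sum_card_fiberwise hmaps, Nat.cast_sum, Finset.mul_sum, ← hcard,
    ← nsmul_eq_mul]
  refine Finset.sum_le_card_nsmul _ _ _ fun m hm => ?_
  simp only [Finset.mem_compl, Finset.mem_insert, Finset.mem_singleton, not_or] at hm
  rw [Finset.filter_filter]
  by_cases hb : e m = k ∨ e m = c
  · rw [Finset.filter_false_of_mem]
    · simp
    · rintro π hπ ⟨⟨-, h2⟩, h3⟩
      obtain ⟨h4, h5⟩ := mem_matchings.1 hπ
      rw [h3] at h2
      rcases hb with hb | hb
      · exact hm.2 (by rw [← h3, ← hb, ← h2, h4])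
      · exact h5 c (h2.trans hb)
  · rw [not_or] at hb
    rw [← card_matchings_apply_eq_apply_eq hm.1 hck (Ne.symm hm.2) hb.1 (he m) hb.2]
    refine le_of_eq ?_
    congr 3
    refine Finset.filter_congr fun π _ => ?_
    constructor
    · rintro ⟨⟨-, h2⟩, h3⟩
      exact ⟨h3, by rw [h2, h3]⟩
    · rintro ⟨h1, h2⟩
      exact ⟨⟨by rw [h1]; exact hm.2, by rw [h1, h2]⟩, h1⟩

/-- The number of points at which `π` agrees with `r`. -/
def agreements (r π : Perm α) : ℕ := (Finset.univ.filter fun k => π k = r k).card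

theorem abs_agreements_reconnect_le {r : Perm α} (hr : ∀ i, r i ≠ i) (hrr : ∀ i, r (r i) ≠ i)
    {π : Perm α} (hπ : π ∈ matchings α) (k : α) :
    |((agreements r π + 1 : ℕ) : ℝ) -
        agreements r (swap (r k) (π k) * π * swap (r k) (π k))| ≤
      (if π k = r k then 1 else 0) + (if π (r k) = r (r k) then 1 else 0) +
      (if π k = r⁻¹ k then 1 else 0) + (if π k ≠ r k ∧ π (r k) = r (π k) then 1 else 0) +
      (if π k ≠ r k ∧ π (r k) = r⁻¹ (π k) then 1 else 0) := by
  obtain ⟨h1, h2⟩ := mem_matchings.1 hπ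
  by_cases hk : π k = r k
  · have : swap (r k) (π k) * π * swap (r k) (π k) = π := by
      rw [hk, swap_self]
      rfl
    rw [this, if_pos hk]
    push_cast
    rw [add_sub_cancel_left, abs_one]
    have a1 : (0 : ℝ) ≤ if π (r k) = r (r k) then 1 else 0 := by split_ifs <;> norm_num
    have a2 : (0 : ℝ) ≤ if π k = r⁻¹ k then 1 else 0 := by split_ifs <;> norm_num
    simp only [hk, ne_eq, not_true_eq_false, false_and, if_false] at a2 ⊢
    linarith
  set c := r k with hc
  set m := π k with hm
  set b := π c with hb
  have hck : c ≠ k := hr k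
  have hmk : m ≠ k := h2 k
  have hπm : π m = k := h1 k
  have hπb : π b = c := h1 c
  have hbk : b ≠ k := fun h => hk (by rw [hm, ← h, hπb])
  have hbc : b ≠ c := h2 c
  have hbm : b ≠ m := fun h => hck (π.injective h)
  set T := swap c m * π * swap c m with hT
  have Tk : T k = c := by
    simp [hT, swap_apply_of_ne_of_ne hck.symm hmk.symm, ← hm]
  have Tc : T c = k := by
    simp [hT, hπm, swap_apply_of_ne_of_ne hck.symm hmk.symm]
  have Tm : T m = b := by
    simp [hT, ← hb, swap_apply_of_ne_of_ne hbc hbm]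
  have Tb : T b = m := by
    simp [hT, swap_apply_of_ne_of_ne hbc hbm, hπb]
  have To : ∀ j, j ≠ k → j ≠ c → j ≠ m → j ≠ b → T j = π j := by
    intro j jk jc jm jb
    have e1 : π j ≠ c := fun h => jb (by rw [hb, ← h, h1])
    have e2 : π j ≠ m := fun h => jk (π.injective h)
    simp [hT, swap_apply_of_ne_of_ne jc jm, swap_apply_of_ne_of_ne e1 e2]
  have hsum : (agreements r T : ℝ) - agreements r π =
      ∑ j ∈ ({k, c, m, b} : Finset α),
        ((if T j = r j then (1 : ℝ) else 0) - if π j = r j then 1 else 0) := by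
    unfold agreements
    rw [Finset.card_filter, Finset.card_filter, Nat.cast_sum, Nat.cast_sum,
      ← Finset.sum_sub_distrib, ← Finset.sum_subset (Finset.subset_univ {k, c, m, b})]
    · push_cast; rfl
    · intro j _ hj
      simp only [Finset.mem_insert, Finset.mem_singleton, not_or] at hj
      rw [To j hj.1 hj.2.1 hj.2.2.1 hj.2.2.2, sub_self]
  rw [Finset.sum_insert (by simp [hck.symm, hmk.symm, hbk.symm]),
    Finset.sum_insert (by simp [Ne.symm hk, hbc.symm]),
    Finset.sum_insert (by simp [hbm.symm]), Finset.sum_singleton, Tk, Tc, Tm, Tb, ← hc, ← hm,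
    ← hb, hπm, hπb] at hsum
  have n1 : k ≠ r c := (hrr k).symm
  have n2 : c ≠ r b := fun h => hbk (r.injective (h.symm.trans hc))
  have i1 : m = r⁻¹ k ↔ k = r m := by rw [Perm.eq_inv_iff_eq, eq_comm]
  have i2 : b = r⁻¹ m ↔ m = r b := by rw [Perm.eq_inv_iff_eq, eq_comm]
  simp only [i1, i2, hk, n1, n2, if_true, if_false, ne_eq, not_false_eq_true, true_and] at hsum ⊢
  rw [abs_le]
  push_cast
  have q : ∀ P : Prop, ∀ [Decidable P], (0 : ℝ) ≤ if P then 1 else 0 := by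
    intro P _; split_ifs <;> norm_num
  have q1 := q (b = r c)
  have q2 := q (k = r m)
  have q3 := q (b = r m)
  have q4 := q (m = r b)
  constructor <;> linarith

theorem abs_sub_le_of_abs_succ_sub_le {g : ℕ → ℝ} {C : ℝ}
    (hg : ∀ j, 1 ≤ j → |g (j + 1) - g j| ≤ C) {a b : ℕ} (ha : 1 ≤ a) (hb : 1 ≤ b) :
    |g a - g b| ≤ C * |(a : ℝ) - b| := by
  have key : ∀ a d : ℕ, 1 ≤ a → |g (a + d) - g a| ≤ C * d := by
    intro a d ha
    induction d with
    | zero => simp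
    | succ d ih =>
      have := hg (a + d) (by omega)
      have h3 := abs_sub_le (g (a + (d + 1))) (g (a + d)) (g a)
      push_cast
      rw [← add_assoc] at h3 ⊢
      linarith
  rcases le_total a b with h | h
  · obtain ⟨d, rfl⟩ := Nat.exists_eq_add_of_le h
    rw [abs_sub_comm, abs_sub_comm (a : ℝ)]
    simpa using key a d ha
  · obtain ⟨d, rfl⟩ := Nat.exists_eq_add_of_le h
    simpa using key b d hb

/-- Expected change in the number of agreements under reconnection at `k`. -/
theorem sum_abs_agreements_reconnect_le {r : Perm α} (hr : ∀ i, r i ≠ i)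
    (hrr : ∀ i, r (r i) ≠ i) (hα : 3 < Fintype.card α) (k : α) :
    ∑ π ∈ matchings α, |((agreements r π + 1 : ℕ) : ℝ) -
        agreements r (swap (r k) (π k) * π * swap (r k) (π k))| ≤
      (matchings α).card / (Fintype.card α - 1) *
        (3 + 2 * ((Fintype.card α - 2) / (Fintype.card α - 3))) := by
  have hN : (3 : ℝ) < Fintype.card α := by exact_mod_cast hα
  have hri : ∀ i, r⁻¹ i ≠ i := fun i h => hr i (by rw [Perm.inv_eq_iff_eq] at h; exact h.symm)
  refine (Finset.sum_le_sum fun π hπ => abs_agreements_reconnect_le hr hrr hπ k).trans ?_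
  simp only [Finset.sum_add_distrib, Finset.sum_boole]
  have h1 := card_matchings_apply_eq (hr k)
  have h2 := card_matchings_apply_eq (hr (r k))
  have h3 := card_matchings_apply_eq (hri k)
  have h4 := card_matchings_apply_eq_perm_apply_le r hr (hr k)
  have h5 := card_matchings_apply_eq_perm_apply_le r⁻¹ hri (hr k)
  have p1 : (0 : ℝ) < Fintype.card α - 1 := by linarith
  have p3 : (0 : ℝ) < Fintype.card α - 3 := by linarith
  rw [mul_comm, ← eq_div_iff p1.ne'] at h1 h2 h3
  rw [mul_comm, ← le_div_iff₀ (mul_pos p1 p3)] at h4 h5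
  rw [h1, h2, h3]
  refine (add_le_add (add_le_add_right h4 _) h5).trans (le_of_eq ?_)
  field_simp
  ring

/-- Stein bound for the number of agreements. -/
theorem abs_sum_stein_agreements_le {r : Perm α} (hr : ∀ i, r i ≠ i)
    (hrr : ∀ i, r (r i) ≠ i) (hα : 3 < Fintype.card α) {g : ℕ → ℝ} {C : ℝ} (hC : 0 ≤ C)
    (hg : ∀ j, 1 ≤ j → |g (j + 1) - g j| ≤ C) :
    |∑ π ∈ matchings α, ((Fintype.card α : ℝ) / (Fintype.card α - 1) * g (agreements r π + 1) -
        agreements r π * g (agreements r π))| ≤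
      C * ((Fintype.card α : ℝ) / (Fintype.card α - 1)) *
        ((matchings α).card / (Fintype.card α - 1) *
          (3 + 2 * ((Fintype.card α - 2) / (Fintype.card α - 3)))) := by
  have hN : (3 : ℝ) < Fintype.card α := by exact_mod_cast hα
  have p1 : (0 : ℝ) < Fintype.card α - 1 := by linarith
  let T : α → Perm α → Perm α := fun k π => swap (r k) (π k) * π * swap (r k) (π k)
  have e1 : ∑ π ∈ matchings α, agreements r π * g (agreements r π) =
      1 / (Fintype.card α - 1) * ∑ k, ∑ π ∈ matchings α, g (agreements r (T k π)) := by
    simp only [T]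
    rw [Finset.sum_congr rfl (fun k _ => sum_matchings_reconnect k (r k) (hr k)
      fun π => g (agreements r π)), ← Finset.mul_sum, ← mul_assoc, one_div_mul_cancel p1.ne',
      one_mul]
    simp only [Finset.sum_filter]
    rw [Finset.sum_comm]
    refine Finset.sum_congr rfl fun π _ => ?_
    rw [← Finset.sum_filter, Finset.sum_const, nsmul_eq_mul]
    rfl
  have e2 : ∑ π ∈ matchings α, (Fintype.card α : ℝ) / (Fintype.card α - 1) *
        g (agreements r π + 1) =
      1 / (Fintype.card α - 1) * ∑ _k : α, ∑ π ∈ matchings α, g (agreements r π + 1) := by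
    rw [← Finset.mul_sum, Finset.sum_const, nsmul_eq_mul, Finset.card_univ]
    ring
  rw [Finset.sum_sub_distrib, e1, e2, ← mul_sub, ← Finset.sum_sub_distrib, abs_mul,
    abs_of_pos (one_div_pos.2 p1)]
  have key : |∑ k : α, (∑ π ∈ matchings α, g (agreements r π + 1) -
      ∑ π ∈ matchings α, g (agreements r (T k π)))| ≤
      Fintype.card α * (C * ((matchings α).card / (Fintype.card α - 1) *
        (3 + 2 * ((Fintype.card α - 2) / (Fintype.card α - 3))))) := by
    refine (Finset.abs_sum_le_sum_abs _ _).trans ?_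
    rw [← nsmul_eq_mul, ← Finset.card_univ]
    refine Finset.sum_le_card_nsmul _ _ _ fun k _ => ?_
    rw [← Finset.sum_sub_distrib]
    refine (Finset.abs_sum_le_sum_abs _ _).trans ?_
    refine le_trans ?_ (mul_le_mul_of_nonneg_left
      (sum_abs_agreements_reconnect_le hr hrr hα k) hC)
    rw [Finset.mul_sum]
    refine Finset.sum_le_sum fun π hπ => ?_
    refine abs_sub_le_of_abs_succ_sub_le hg (by omega) (Finset.card_pos.2 ⟨k, ?_⟩)
    have hne : k ≠ π k := ((mem_matchings.1 hπ).2 k).symm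
    rw [Finset.mem_filter]
    exact ⟨Finset.mem_univ k, by simp [T, swap_apply_of_ne_of_ne (hr k).symm hne]⟩
  refine (mul_le_mul_of_nonneg_left key (one_div_pos.2 p1).le).trans (le_of_eq ?_)
  ring

end Matchings

theorem finRotate_ne_self {N : ℕ} (hN : 3 ≤ N) (i : Fin N) : finRotate N i ≠ i := by
  obtain ⟨m, rfl⟩ := Nat.exists_eq_add_of_le' hN
  rw [finRotate_apply, Ne, add_eq_left]
  simp

theorem finRotate_finRotate_ne_self {N : ℕ} (hN : 3 ≤ N) (i : Fin N) :
    finRotate N (finRotate N i) ≠ i := by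
  obtain ⟨m, rfl⟩ := Nat.exists_eq_add_of_le' hN
  rw [finRotate_apply, finRotate_apply, add_assoc, Ne, add_eq_left]
  simp [Fin.ext_iff, Fin.val_add, Nat.mod_eq_of_lt (show 2 < m + 2 + 1 by omega)]

theorem matchings_fin_two_mul_nonempty (n : ℕ) : (matchings (Fin (2 * n))).Nonempty := by
  refine ⟨Fin.revPerm, mem_matchings.2 ⟨fun i => by simp, fun i h => ?_⟩⟩
  have := congrArg Fin.val h
  simp only [Fin.revPerm_apply, Fin.val_rev] at this
  omega

theorem setOf_isChordDiagram (n : ℕ) :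
    {π : Equiv.Perm (Fin (2 * n)) | IsChordDiagram π} = matchings (Fin (2 * n)) := by
  ext π
  simp [IsChordDiagram, mem_matchings]

instance (n : ℕ) : IsProbabilityMeasure (uniformCD n) :=
  isProbabilityMeasure_uniformOn (Set.toFinite _) <| by
    rw [setOf_isChordDiagram]
    exact matchings_fin_two_mul_nonempty n

theorem uniformCD_toReal (n : ℕ) (A : Set ℕ) :
    ((uniformCD n) {π | simpleChords π ∈ A}).toReal =
      (∑ π ∈ matchings (Fin (2 * n)), A.indicator 1 (agreements (finRotate (2 * n)) π)) /
        ((matchings (Fin (2 * n))).card : ℝ) := by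
  classical
  have h : {π : Equiv.Perm (Fin (2 * n)) | simpleChords π ∈ A} =
      ((Finset.univ.filter fun π => simpleChords π ∈ A : Finset (Equiv.Perm (Fin (2 * n)))) :
        Set (Equiv.Perm (Fin (2 * n)))) := by simp
  rw [uniformCD, setOf_isChordDiagram, h, uniformOn_apply_finset, ENNReal.toReal_div,
    ENNReal.toReal_natCast, ENNReal.toReal_natCast, Finset.inter_filter, Finset.inter_univ,
    Finset.card_filter, Nat.cast_sum]
  congr 1
  refine Finset.sum_congr rfl fun π _ => ?_
  rw [Set.indicator_apply]
  push_cast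
  rfl

theorem poissonMeasure_toReal (r : ℝ≥0) (A : Set ℕ) :
    ((poissonMeasure r) A).toReal =
      ∑' i, A.indicator 1 i * (Real.exp (-r) * r ^ i / (i)! : ℝ) := by
  rw [← measureReal_def, ← integral_indicator_one (.of_discrete), integral_poissonMeasure]
  exact tsum_congr fun i => by rw [smul_eq_mul, mul_comm]

/-- For `n ≥ 2`, `d_TV(S_n, Poisson(2n/(2n-1))) ≤ 10n/(2n-1)² ≤ 10/n`. -/
theorem simpleChords_poisson_tv_bound (n : ℕ) (hn : 2 ≤ n) :
    (∀ A : Set ℕ,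
      |((uniformCD n) {π | simpleChords π ∈ A}).toReal -
          ((poissonMeasure ((2 * n : ℝ≥0) / (2 * (n : ℝ≥0) - 1))) A).toReal|
        ≤ 10 * n / (2 * (n : ℝ) - 1) ^ 2) ∧
    10 * n / (2 * (n : ℝ) - 1) ^ 2 ≤ 10 / n := by
  have hn' : (2 : ℝ) ≤ n := by exact_mod_cast hn
  have hpos : (0 : ℝ) < 2 * n - 1 := by linarith
  refine ⟨fun A => ?_, ?_⟩
  swap
  · rw [div_le_div_iff₀ (by positivity) (by positivity)]
    nlinarith
  rcases hn.eq_or_lt with rfl | hn3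
  · have h1 : ((uniformCD 2) {π | simpleChords π ∈ A}).toReal ≤ 1 := measureReal_le_one
    have h2 : ((poissonMeasure ((2 * (2 : ℕ) : ℝ≥0) / (2 * ((2 : ℕ) : ℝ≥0) - 1))) A).toReal ≤ 1 :=
      measureReal_le_one
    refine (abs_sub_le_of_nonneg_of_le ENNReal.toReal_nonneg h1 ENNReal.toReal_nonneg h2).trans ?_
    norm_num
  have hn3' : (3 : ℝ) ≤ n := by exact_mod_cast hn3
  set r : ℝ≥0 := (2 * n : ℝ≥0) / (2 * (n : ℝ≥0) - 1) with hr
  have hrc : (r : ℝ) = 2 * n / (2 * n - 1) := by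
    have : (1 : ℝ≥0) ≤ 2 * (n : ℝ≥0) := by exact_mod_cast (by omega : 1 ≤ 2 * n)
    rw [hr, NNReal.coe_div, NNReal.coe_sub this]
    simp
  have hr0 : (0 : ℝ) < r := by rw [hrc]; positivity
  obtain ⟨g, hg, hgd⟩ := exists_poisson_stein_solution hr0
    (p := fun j => Real.exp (-r) * r ^ j / (j)!) (fun j => by positivity)
    (fun j => by
      rw [Nat.factorial_succ]
      push_cast
      field_simp
      ring)
    (hasSum_one_poissonMeasure r)
    (f := A.indicator 1) (fun j => Set.indicator_nonneg (fun _ _ => zero_le_one) j)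
    (fun j => Set.indicator_le_self' (f := (1 : ℕ → ℝ)) (fun _ _ => zero_le_one) j)
  have hcard : Fintype.card (Fin (2 * n)) = 2 * n := Fintype.card_fin _
  have key := abs_sum_stein_agreements_le (finRotate_ne_self (by omega : 3 ≤ 2 * n))
    (finRotate_finRotate_ne_self (by omega)) (by omega) (by positivity : 0 ≤ 1 / (r : ℝ)) hgd
  have hM : (0 : ℝ) < (matchings (Fin (2 * n))).card := by
    exact_mod_cast (matchings_fin_two_mul_nonempty n).card_pos
  rw [hcard] at key
  push_cast at key
  rw [← hrc, Finset.sum_congr rfl fun π _ => hg (agreements (finRotate (2 * n)) π),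
    Finset.sum_sub_distrib, Finset.sum_const, nsmul_eq_mul, one_div_mul_cancel hr0.ne',
    one_mul] at key
  rw [uniformCD_toReal, poissonMeasure_toReal, div_sub' hM.ne', abs_div, abs_of_pos hM,
    div_le_iff₀ hM]
  refine key.trans ?_
  have h3 : (0 : ℝ) < 2 * n - 3 := by linarith
  have e : 3 + 2 * ((2 * (n : ℝ) - 2) / (2 * n - 3)) ≤ 10 * n / (2 * n - 1) := by
    rw [mul_div_assoc', add_div' _ _ _ h3.ne', div_le_div_iff₀ h3 hpos]
    nlinarith
  refine (mul_le_mul_of_nonneg_left e (by positivity)).trans (le_of_eq ?_)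
  field_simp
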